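/- Let ℓ be an odd prime and let χ : 𝔽_ℓ^× → {±1} be a nontrivial group homomorphism. Among the matrices M ∈ GL₂(𝔽_ℓ) that are not special, exactly (1/2)(ℓ²−1)(ℓ²−ℓ) − ℓ² of them satisfy χ(det M) = 1, and exactly (1/2)(ℓ²−1)(ℓ²−ℓ) of them satisfy χ(det M) = −1. -/

import Mathlib

open Matrix
open scoped MatrixGroups

/-- A matrix in `GL₂` is *special* if it has determinant 1 and fixes a nonzero vector. -/
def Special {R : Type*} [CommRing R] (M : GL (Fin 2) R) : Prop :=
  (M : Matrix (Fin 2) (Fin 2) R).det = 1 ∧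
    ∃ v : Fin 2 → R, v ≠ 0 ∧ (M : Matrix (Fin 2) (Fin 2) R).mulVec v = v

/-- A `2 × 2` matrix over a field is special exactly when it has determinant `1` and trace `2`. -/
lemma special_iff_det_trace {F : Type*} [Field F] (M : GL (Fin 2) F) :
    Special M ↔ M 0 0 * M 1 1 - M 0 1 * M 1 0 = 1 ∧ M 0 0 + M 1 1 = 2 := by
  have fixes : (∃ v : Fin 2 → F, v ≠ 0 ∧ (M : Matrix (Fin 2) (Fin 2) F).mulVec v = v) ↔
      ((M : Matrix (Fin 2) (Fin 2) F) - 1).det = 0 := by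
    rw [← Matrix.exists_mulVec_eq_zero_iff]
    simp only [Matrix.sub_mulVec, Matrix.one_mulVec, sub_eq_zero]
  unfold Special
  rw [fixes, Matrix.det_fin_two, Matrix.det_fin_two]
  refine and_congr_right fun h => ?_
  simp only [Matrix.sub_apply, Matrix.one_apply_eq, Matrix.one_apply_ne zero_ne_one,
    Matrix.one_apply_ne one_ne_zero, sub_zero]
  constructor <;> intro heq <;> linear_combination h - heq

/-- Special matrices are `1 + N` with `N` nilpotent. Such an `N` is determined by its upper right
entry `b` together with its upper left entry if `b ≠ 0`, and its lower left entry if `b = 0`. -/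
lemma card_special (F : Type*) [Field F] :
    Nat.card {M : GL (Fin 2) F // Special M} = Nat.card F ^ 2 := by
  classical
  let mk (x b c : F) (h : x ^ 2 + b * c = 0) : GL (Fin 2) F :=
    Matrix.GeneralLinearGroup.mkOfDetNeZero !![1 + x, b; c, 1 - x] (by
      rw [Matrix.det_fin_two_of, show (1 + x) * (1 - x) - b * c = 1 by linear_combination -h]
      exact one_ne_zero)
  have special_mk (x b c : F) (h : x ^ 2 + b * c = 0) : Special (mk x b c h) := by
    rw [special_iff_det_trace]
    refine ⟨?_, ?_⟩
    · change (1 + x) * (1 - x) - b * c = 1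
      linear_combination -h
    · change (1 + x) + (1 - x) = 2
      ring
  let mkSpecial (x b c : F) (h : x ^ 2 + b * c = 0) : {M : GL (Fin 2) F // Special M} :=
    ⟨mk x b c h, special_mk x b c h⟩
  let e : {M : GL (Fin 2) F // Special M} ≃ F × F :=
    { toFun := fun M => (M.1 0 1, if M.1 0 1 = 0 then M.1 1 0 else M.1 0 0 - 1)
      invFun := fun p => if hb : p.1 = 0 then mkSpecial 0 0 p.2 (by ring)
        else mkSpecial p.2 p.1 (-p.2 ^ 2 / p.1) (by field_simp; ring)
      left_inv := by
        rintro ⟨M, hM⟩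
        obtain ⟨hd, ht⟩ := (special_iff_det_trace M).1 hM
        have hsq : (M 0 0 - 1) ^ 2 = -(M 0 1 * M 1 0) := by
          linear_combination M 0 0 * ht - hd
        by_cases hb : M 0 1 = 0
        · have ha : M 0 0 = 1 := by
            rw [hb, zero_mul, neg_zero] at hsq
            exact sub_eq_zero.1 (pow_eq_zero_iff two_ne_zero |>.1 hsq)
          have hd' : M 1 1 = 1 := by linear_combination ht - ha
          simp only [hb, if_true, dif_pos]
          refine Subtype.ext (Units.ext ?_)
          ext i j
          fin_cases i <;> fin_cases j <;>
            simp [mkSpecial, mk, Matrix.GeneralLinearGroup.mkOfDetNeZero, ha, hb, hd']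
        · have hd' : M 1 1 = 1 - (M 0 0 - 1) := by linear_combination ht
          have hc : -(M 0 0 - 1) ^ 2 / M 0 1 = M 1 0 := by
            rw [hsq]; field_simp
          simp only [hb, if_false, dif_neg, not_false_eq_true]
          refine Subtype.ext (Units.ext ?_)
          ext i j
          fin_cases i <;> fin_cases j <;>
            simp [mkSpecial, mk, Matrix.GeneralLinearGroup.mkOfDetNeZero, hd', hc]
      right_inv := by
        rintro ⟨b, t⟩
        by_cases hb : b = 0 <;> simp [mkSpecial, mk, Matrix.GeneralLinearGroup.mkOfDetNeZero, hb] }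
  rw [Nat.card_congr e, Nat.card_prod, sq]

/-- The two fibres of a nontrivial sign character of a finite group have equal size. -/
lemma card_filter_sign_eq {G : Type*} [Group G] [Fintype G] (ψ : G →* ℤˣ) {g : G}
    (hg : ψ g = -1) :
    (Finset.univ.filter fun x => ψ x = 1).card = (Finset.univ.filter fun x => ψ x = -1).card := by
  refine Finset.card_bij' (fun x _ => g * x) (fun x _ => g⁻¹ * x) ?_ ?_ ?_ ?_ <;>
    simp +contextual [hg]

open Classical in
/-- Let `ℓ` be an odd prime and `χ : 𝔽_ℓˣ → {±1}` a nontrivial homomorphism.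
Among the non-special matrices of `GL₂(𝔽_ℓ)`, exactly `(1/2)(ℓ²−1)(ℓ²−ℓ) − ℓ²` have
`χ(det M) = 1` and exactly `(1/2)(ℓ²−1)(ℓ²−ℓ)` have `χ(det M) = −1`. -/
theorem card_chi_det_not_special {ℓ : ℕ} [Fact ℓ.Prime] (hℓ : ℓ ≠ 2)
    (χ : (ZMod ℓ)ˣ →* ℤˣ) (hχ : ∃ u : (ZMod ℓ)ˣ, χ u = -1) :
    (((Finset.univ.filter (fun M : GL (Fin 2) (ZMod ℓ) =>
        ¬ Special M ∧ χ (Matrix.GeneralLinearGroup.det M) = 1)).card : ℚ) =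
      1 / 2 * ((ℓ : ℚ) ^ 2 - 1) * ((ℓ : ℚ) ^ 2 - ℓ) - (ℓ : ℚ) ^ 2) ∧
    (((Finset.univ.filter (fun M : GL (Fin 2) (ZMod ℓ) =>
        ¬ Special M ∧ χ (Matrix.GeneralLinearGroup.det M) = -1)).card : ℚ) =
      1 / 2 * ((ℓ : ℚ) ^ 2 - 1) * ((ℓ : ℚ) ^ 2 - ℓ)) := by
  let ψ : GL (Fin 2) (ZMod ℓ) →* ℤˣ := χ.comp Matrix.GeneralLinearGroup.det
  obtain ⟨u, hu⟩ := hχ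
  obtain ⟨g, hg⟩ : ∃ g, ψ g = -1 := by
    refine ⟨Matrix.GeneralLinearGroup.mkOfDetNeZero !![(u : ZMod ℓ), 0; 0, 1] (by simp), ?_⟩
    rw [← hu]
    refine congrArg χ (Units.ext ?_)
    simp [Matrix.GeneralLinearGroup.mkOfDetNeZero]
  have special_det {M : GL (Fin 2) (ZMod ℓ)} (hM : Special M) : ψ M = 1 := by
    have : Matrix.GeneralLinearGroup.det M = 1 := Units.ext hM.1
    simp [ψ, this]
  have hGL : (Fintype.card (GL (Fin 2) (ZMod ℓ)) : ℚ) =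
      ((ℓ : ℚ) ^ 2 - 1) * ((ℓ : ℚ) ^ 2 - ℓ) := by
    have h1 : 1 ≤ ℓ ^ 2 := Nat.one_le_pow _ _ (Fact.out : ℓ.Prime).pos
    have h2 : ℓ ≤ ℓ ^ 2 := Nat.le_self_pow two_ne_zero ℓ
    rw [← Nat.card_eq_fintype_card, Matrix.card_GL_field]
    simp [Fin.prod_univ_two, ZMod.card, Nat.cast_sub h1, Nat.cast_sub h2]
  have hsum : (Finset.univ.filter fun M => ψ M = 1).card +
      (Finset.univ.filter fun M => ψ M = -1).card = Fintype.card (GL (Fin 2) (ZMod ℓ)) := by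
    rw [← Finset.card_univ, ← Finset.card_filter_add_card_filter_not (s := Finset.univ)
      (fun M => ψ M = 1)]
    refine congrArg₂ (· + ·) rfl (congrArg Finset.card ?_)
    ext M
    simp [Int.units_ne_iff_eq_neg]
  have hhalf := card_filter_sign_eq ψ hg
  have hspecial : (Finset.univ.filter fun M : GL (Fin 2) (ZMod ℓ) => Special M).card = ℓ ^ 2 := by
    rw [← Fintype.card_subtype, ← Nat.card_eq_fintype_card, card_special, Nat.card_zmod]
  have hpos : (Finset.univ.filter fun M : GL (Fin 2) (ZMod ℓ) => Special M).card +
      (Finset.univ.filter fun M => ¬ Special M ∧ ψ M = 1).card =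
      (Finset.univ.filter fun M => ψ M = 1).card := by
    rw [← Finset.card_filter_add_card_filter_not (s := Finset.univ.filter fun M => ψ M = 1)
      (fun M => Special M), Finset.filter_filter, Finset.filter_filter]
    refine congrArg₂ (· + ·) (congrArg Finset.card ?_) (congrArg Finset.card ?_) <;> ext M <;>
      simp only [Finset.mem_filter_univ]
    · exact ⟨fun h => ⟨special_det h, h⟩, And.right⟩
    · exact and_comm
  have hneg : (Finset.univ.filter fun M => ¬ Special M ∧ ψ M = -1) =
      Finset.univ.filter fun M => ψ M = -1 := by
    ext M
    simp only [Finset.mem_filter_univ, and_iff_right_iff_imp]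
    intro h hM
    exact absurd (h.symm.trans (special_det hM)) (by decide)
  change ((Finset.univ.filter fun M => ¬ Special M ∧ ψ M = 1).card : ℚ) = _ ∧
    ((Finset.univ.filter fun M => ¬ Special M ∧ ψ M = -1).card : ℚ) = _
  rw [hneg]
  rw [hspecial] at hpos
  qify at hsum hhalf hpos
  constructor <;> linarith
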